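/- Let W : ℝ^p × ℝ^d → ℝ^d be twice continuously differentiable with all first- and second-order partial derivatives bounded in norm by a constant K. Suppose φ : [0,1] × ℝ^p × ℝ^d → ℝ^d satisfies the integral equation φ(t, a, x) = x + ∫₀ᵗ W(a, φ(s, a, x)) ds for all (t, a, x), that for each fixed (t, x) the map a ↦ φ(t, a, x) is twice continuously differentiable, and that the first and second derivatives in a of φ are jointly continuous in (t, a, x). Then sup { ‖D²_a φ(t, a, x)‖ : t ∈ [0,1], |a| ≤ 1, x ∈ ℝ^d } < ∞. -/

import Mathlib

open Set MeasureTheory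

lemma aux_gron {E : Type*} [NormedAddCommGroup E] [NormedSpace ℝ E] {M e T : ℝ} (hM : 1 ≤ M)
    (he : 0 ≤ e) (u u' : ℝ → E) (hc : ContinuousOn u (Icc 0 T))
    (hd : ∀ s ∈ Ico 0 T, HasDerivWithinAt u (u' s) (Ici s) s) (h0 : u 0 = 0)
    (hb : ∀ s ∈ Ico 0 T, ‖u' s‖ ≤ M * ‖u s‖ + e) :
    ∀ s ∈ Icc 0 T, ‖u s‖ ≤ e * Real.exp (M * T) := by
  intro s hs
  have h := norm_le_gronwallBound_of_norm_deriv_right_le (δ := 0) hc hd (by simp [h0]) hb s hs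
  have hM0 : M ≠ 0 := by positivity
  rw [gronwallBound_of_K_ne_0 hM0] at h
  have h1 : Real.exp (M * (s - 0)) ≤ Real.exp (M * T) := by
    apply Real.exp_le_exp.2
    have := hs.2
    nlinarith
  have h2 : e / M ≤ e := div_le_self he hM
  have h3 : 0 ≤ e / M := by positivity
  have h4 := Real.exp_pos (M * T)
  calc ‖u s‖ ≤ _ := h
    _ ≤ e / M * Real.exp (M * T) := by nlinarith
    _ ≤ _ := by gcongr

lemma aux_deriv {E : Type*} [NormedAddCommGroup E] [NormedSpace ℝ E] [CompleteSpace E]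
    (V : E → E) (hV : Continuous V) (x : E) (f : ℝ → E)
    (hf : ∀ t, f t = x + ∫ s in (0:ℝ)..t, V (f s)) {T : ℝ} (hT : 0 ≤ T)
    (hi : IntervalIntegrable (fun s => V (f s)) volume 0 T) :
    ContinuousOn f (Icc 0 T) ∧
      ∀ s ∈ Ico 0 T, HasDerivWithinAt f (V (f s)) (Ici s) s := by
  have hc : ContinuousOn f (Icc 0 T) := by
    have h := intervalIntegral.continuousOn_primitive_interval
      (μ := volume) (a := 0) (b := T) (f := fun s => V (f s))
      ((intervalIntegrable_iff').1 hi)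
    rw [uIcc_of_le hT] at h
    refine (continuousOn_const (c := x)).add h |>.congr ?_
    intro t _
    exact hf t
  refine ⟨hc, fun s hs => ?_⟩
  have hg : ContinuousOn (fun s => V (f s)) (Icc 0 T) := hV.comp_continuousOn hc
  have hmem : Icc 0 T ∈ nhdsWithin s (Ici s) :=
    Filter.mem_of_superset (Icc_mem_nhdsGE hs.2) (Icc_subset_Icc_left hs.1)
  have hmem' : Icc 0 T ∈ nhdsWithin s (Ioi s) :=
    nhdsWithin_mono _ Ioi_subset_Ici_self hmem
  have hcw : ContinuousWithinAt (fun s => V (f s)) (Ici s) s :=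
    (hg s ⟨hs.1, hs.2.le⟩).mono_of_mem_nhdsWithin hmem
  have hI : IntervalIntegrable (fun s => V (f s)) volume 0 s :=
    hi.mono_set (by rw [uIcc_of_le hT, uIcc_of_le hs.1]; exact Icc_subset_Icc_right hs.2.le)
  have hmeas : StronglyMeasurableAtFilter (fun s => V (f s)) (nhdsWithin s (Ioi s)) volume :=
    ⟨Icc 0 T, hmem', hg.aestronglyMeasurable measurableSet_Icc⟩
  have h := intervalIntegral.integral_hasDerivWithinAt_right hI (s := Ici s) (t := Ioi s) hmeas
    (hcw.mono Ioi_subset_Ici_self)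
  have h2 := h.const_add x
  refine h2.congr (fun t _ => hf t) (hf s)

lemma aux_int {E : Type*} [NormedAddCommGroup E] [NormedSpace ℝ E] [CompleteSpace E]
    (V : E → E) (hV : Continuous V) {M : ℝ} (hM : 1 ≤ M)
    (hL : ∀ y z, ‖V y - V z‖ ≤ M * ‖y - z‖) (x : E) (f : ℝ → E)
    (hf : ∀ t, f t = x + ∫ s in (0:ℝ)..t, V (f s)) {T : ℝ} (hT : 0 ≤ T) :
    IntervalIntegrable (fun s => V (f s)) volume 0 T := by
  set S : Set ℝ := {t | 0 ≤ t ∧ IntervalIntegrable (fun s => V (f s)) volume 0 t} with hS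
  have hf0 : f 0 = x := by rw [hf]; simp
  have hdown : ∀ t ∈ S, ∀ s, 0 ≤ s → s ≤ t → s ∈ S := fun t ht s hs hst =>
    ⟨hs, ht.2.mono_set (by
      rw [uIcc_of_le ht.1, uIcc_of_le hs]; exact Icc_subset_Icc_right hst)⟩
  have hout : ∀ t, 0 ≤ t → t ∉ S → f t = x := by
    intro t ht hn
    rw [hf, intervalIntegral.integral_undef, add_zero]
    exact fun h => hn ⟨ht, h⟩
  have hord : OrdConnected S := ⟨fun a ha b hb c hc => hdown b hb c (ha.1.trans hc.1) hc.2⟩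
  have hcS : ContinuousOn f S := by
    intro t ht
    by_cases h : ∃ t' ∈ S, t < t'
    · obtain ⟨t', ht', htt⟩ := h
      have h1 := (aux_deriv V hV x f hf ht'.1 ht'.2).1 t ⟨ht.1, htt.le⟩
      refine h1.mono_of_mem_nhdsWithin ?_
      have h2 : Iic t' ∈ nhdsWithin t S := mem_nhdsWithin_of_mem_nhds (Iic_mem_nhds htt)
      filter_upwards [h2, self_mem_nhdsWithin] with s hs hs'
      exact ⟨hs'.1, hs⟩
    · push Not at h
      exact ((aux_deriv V hV x f hf ht.1 ht.2).1 t ⟨ht.1, le_rfl⟩).mono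
        (fun s hs => ⟨hs.1, h s hs⟩)
  have hbound : ∀ t ∈ Icc 0 T, ‖f t - x‖ ≤ ‖V x‖ * Real.exp (M * T) := by
    intro t ht
    by_cases hn : t ∈ S
    · obtain ⟨h1, h2⟩ := aux_deriv V hV x f hf hn.1 hn.2
      have := aux_gron hM (norm_nonneg (V x)) (fun s => f s - x) (fun s => V (f s))
        (h1.sub continuousOn_const) (fun s hs => (h2 s hs).sub_const x) (by simp [hf0])
        (fun s hs => by
          have h3 := hL (f s) x
          have h4 := norm_le_norm_sub_add (V (f s)) (V x)
          linarith) t ⟨hn.1, le_rfl⟩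
      refine this.trans ?_
      have := ht.2
      gcongr
    · rw [hout t ht.1 hn]; simp; positivity
  have hmeas : AEStronglyMeasurable f (volume.restrict (Ici 0)) := by
    have hu : Ici (0:ℝ) = S ∪ (Ici 0 \ S) := by
      rw [union_sdiff_cancel]; exact fun s hs => hs.1
    have hmS : MeasurableSet S := hord.measurableSet
    rw [hu, aestronglyMeasurable_union_iff]
    refine ⟨hcS.aestronglyMeasurable hmS, ?_⟩
    refine (aestronglyMeasurable_const (b := x)).congr ?_
    filter_upwards [ae_restrict_mem (measurableSet_Ici.diff hmS)] with s hs
    exact (hout s hs.1 hs.2).symm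
  rw [intervalIntegrable_iff_integrableOn_Icc_of_le hT]
  refine IntegrableOn.of_bound (by simp) ?_
    (M * (‖V x‖ * Real.exp (M * T)) + ‖V x‖) ?_
  · exact hV.comp_aestronglyMeasurable
      (hmeas.mono_measure (Measure.restrict_mono Icc_subset_Ici_self le_rfl))
  · filter_upwards [ae_restrict_mem measurableSet_Icc] with s hs
    have h3 := hL (f s) x
    have h4 := norm_le_norm_sub_add (V (f s)) (V x)
    have h5 := hbound s hs
    nlinarith

/-- four-point estimate for a `C²` map with bounded second derivative -/
lemma aux_four {E F : Type*} [NormedAddCommGroup E] [NormedSpace ℝ E]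
    [NormedAddCommGroup F] [NormedSpace ℝ F] (W : E → F) (hW : ContDiff ℝ 2 W) {K : ℝ}
    (hD2 : ∀ z, ‖iteratedFDeriv ℝ 2 W z‖ ≤ K) (z p q : E) :
    ‖W (z + p + q) - W (z + p) - W (z + q) + W z‖ ≤ K * ‖p‖ * ‖q‖ := by
  have hd : Differentiable ℝ W := hW.differentiable (by norm_num)
  have hd2 : Differentiable ℝ (fderiv ℝ W) :=
    (hW.fderiv_right (m := 1) (by norm_num)).differentiable (by norm_num)
  have hb : ∀ y, ‖fderiv ℝ (fderiv ℝ W) y‖ ≤ K := fun y => by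
    rw [← norm_iteratedFDeriv_one, norm_iteratedFDeriv_fderiv]; exact hD2 y
  have h1 : ∀ y, ‖fderiv ℝ W (y + p) - fderiv ℝ W y‖ ≤ K * ‖p‖ := fun y => by
    simpa using convex_univ.norm_image_sub_le_of_norm_fderiv_le (𝕜 := ℝ)
      (fun y _ => hd2 y) (fun y _ => hb y) (mem_univ y) (mem_univ (y + p))
  have h2 : ∀ y, HasFDerivAt (fun y => W (y + p) - W y)
      (fderiv ℝ W (y + p) - fderiv ℝ W y) y := fun y => by
    refine HasFDerivAt.sub ?_ (hd y).hasFDerivAt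
    exact (hasFDerivAt_comp_add_right p).2 (hd (y + p)).hasFDerivAt
  have h3 := convex_univ.norm_image_sub_le_of_norm_hasFDerivWithin_le
      (fun y _ => (h2 y).hasFDerivWithinAt) (fun y _ => h1 y) (mem_univ z) (mem_univ (z + q))
  simp only [add_sub_cancel_left] at h3
  convert h3 using 2
  rw [add_right_comm]
  abel

/-- converse of the four-point estimate -/
lemma aux_conv {E F : Type*} [NormedAddCommGroup E] [NormedSpace ℝ E]
    [NormedAddCommGroup F] [NormedSpace ℝ F] (f : E → F) (hf : ContDiff ℝ 2 f) {C : ℝ}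
    (hC : 0 ≤ C)
    (h : ∀ z p q, ‖f (z + p + q) - f (z + p) - f (z + q) + f z‖ ≤ C * ‖p‖ * ‖q‖) (a : E) :
    ‖iteratedFDeriv ℝ 2 f a‖ ≤ C := by
  have hd : Differentiable ℝ f := hf.differentiable (by norm_num)
  have h1 : ∀ y p, ‖fderiv ℝ f (y + p) - fderiv ℝ f y‖ ≤ C * ‖p‖ := fun y p => by
    have h2 : HasFDerivAt (fun y => f (y + p) - f y)
      (fderiv ℝ f (y + p) - fderiv ℝ f y) y := by
      refine HasFDerivAt.sub ?_ (hd y).hasFDerivAt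
      exact (hasFDerivAt_comp_add_right p).2 (hd (y + p)).hasFDerivAt
    refine h2.le_of_lip' (by positivity) (Filter.Eventually.of_forall fun w => ?_)
    have := h y p (w - y)
    convert this using 2
    rw [add_sub_cancel, show y + p + (w - y) = w + p by abel]
    abel
  rw [← norm_iteratedFDeriv_fderiv (n := 1), norm_iteratedFDeriv_one]
  refine norm_fderiv_le_of_lip' ℝ hC (Filter.Eventually.of_forall fun w => ?_)
  simpa using h1 a (w - a)

/-- Lemma 8: uniform bound on the second derivative in the parameter `a` of the flow
`φ_t(a,·)` of the parameter-dependent ODE `ẋ = W(a,x)`, over `t ∈ [0,1]`, `|a| ≤ 1`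
and all starting points `x`. -/
theorem parameter_second_derivative_bounded
    (p d : ℕ)
    (W : EuclideanSpace ℝ (Fin p) × EuclideanSpace ℝ (Fin d) → EuclideanSpace ℝ (Fin d))
    (K : ℝ)
    (hWC2 : ContDiff ℝ 2 W)
    (hWD1 : ∀ z, ‖fderiv ℝ W z‖ ≤ K)
    (hWD2 : ∀ z, ‖iteratedFDeriv ℝ 2 W z‖ ≤ K)
    (φ : ℝ × EuclideanSpace ℝ (Fin p) × EuclideanSpace ℝ (Fin d) → EuclideanSpace ℝ (Fin d))
    (hInt : ∀ t a x, φ (t, a, x) = x + ∫ s in (0:ℝ)..t, W (a, φ (s, a, x)))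
    (hC2 : ∀ t x, ContDiff ℝ 2 (fun a => φ (t, a, x)))
    (hCont1 : Continuous (fun z : ℝ × EuclideanSpace ℝ (Fin p) × EuclideanSpace ℝ (Fin d) =>
        fderiv ℝ (fun a => φ (z.1, a, z.2.2)) z.2.1))
    (hCont2 : Continuous (fun z : ℝ × EuclideanSpace ℝ (Fin p) × EuclideanSpace ℝ (Fin d) =>
        iteratedFDeriv ℝ 2 (fun a => φ (z.1, a, z.2.2)) z.2.1)) :
    ∃ C : ℝ, ∀ t ∈ Icc (0:ℝ) 1, ∀ a : EuclideanSpace ℝ (Fin p), ‖a‖ ≤ 1 →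
      ∀ x : EuclideanSpace ℝ (Fin d),
        ‖iteratedFDeriv ℝ 2 (fun a' => φ (t, a', x)) a‖ ≤ C := by
  have hM : 1 ≤ max K 1 := le_max_right _ _
  have hM1 : ∀ z, ‖fderiv ℝ W z‖ ≤ max K 1 := fun z => (hWD1 z).trans (le_max_left _ _)
  have hM2 : ∀ z, ‖iteratedFDeriv ℝ 2 W z‖ ≤ max K 1 := fun z => (hWD2 z).trans (le_max_left _ _)
  generalize max K 1 = M at hM hM1 hM2
  have hM0 : 0 ≤ M := by positivity
  have hWd : Differentiable ℝ W := hWC2.differentiable (by norm_num)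
  have hLip : ∀ y z, ‖W y - W z‖ ≤ M * ‖y - z‖ := fun y z =>
    convex_univ.norm_image_sub_le_of_norm_fderiv_le (𝕜 := ℝ)
      (fun y _ => hWd y) (fun y _ => hM1 y) (mem_univ z) (mem_univ y)
  have hφ0 : ∀ a x, φ (0, a, x) = x := fun a x => by rw [hInt]; simp
  have key : ∀ a x, ContinuousOn (fun t => φ (t, a, x)) (Icc 0 1) ∧
      ∀ s ∈ Ico (0:ℝ) 1, HasDerivWithinAt (fun t => φ (t, a, x)) (W (a, φ (s, a, x)))
        (Ici s) s := by
    intro a x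
    have hV : Continuous (fun y => W (a, y)) := hWd.continuous.comp (by fun_prop)
    have hVL : ∀ y z, ‖W (a, y) - W (a, z)‖ ≤ M * ‖y - z‖ := fun y z => by
      simpa [Prod.norm_def] using hLip (a, y) (a, z)
    exact aux_deriv (fun y => W (a, y)) hV x (fun t => φ (t, a, x)) (fun t => hInt t a x)
      zero_le_one (aux_int (fun y => W (a, y)) hV hM hVL x (fun t => φ (t, a, x))
        (fun t => hInt t a x) zero_le_one)
  -- Lipschitz bound in the parameter
  have lip : ∀ x a b, ∀ t ∈ Icc (0:ℝ) 1,
      ‖φ (t, a, x) - φ (t, b, x)‖ ≤ M * ‖a - b‖ * Real.exp (M * 1) := by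
    intro x a b
    refine aux_gron (u := fun t => φ (t, a, x) - φ (t, b, x)) hM (by positivity) _
      ((key a x).1.sub (key b x).1)
      (fun s hs => ((key a x).2 s hs).sub ((key b x).2 s hs)) (by simp [hφ0]) ?_
    intro s _
    refine (hLip _ _).trans ?_
    rw [← mul_add]
    refine mul_le_mul_of_nonneg_left ?_ hM0
    rw [Prod.mk_sub_mk, Prod.norm_def, add_comm]
    exact max_le_add_of_nonneg (norm_nonneg _) (norm_nonneg _)
  set B : ℝ := 1 + M * Real.exp (M * 1) with hB
  have hB0 : 0 ≤ B := by positivity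
  have lip2 : ∀ x a b, ∀ t ∈ Icc (0:ℝ) 1,
      ‖((a, φ (t, a, x)) : EuclideanSpace ℝ (Fin p) × EuclideanSpace ℝ (Fin d))
        - (b, φ (t, b, x))‖ ≤ B * ‖a - b‖ := by
    intro x a b t ht
    rw [Prod.mk_sub_mk, Prod.norm_def]
    refine (max_le_add_of_nonneg (norm_nonneg _) (norm_nonneg _)).trans ?_
    have := lip x a b t ht
    rw [hB]; simp only; linarith
  refine ⟨M * B ^ 2 * Real.exp (M * 1), fun t ht a _ x => ?_⟩
  refine aux_conv _ (hC2 t x) (by positivity) (fun z v w => ?_) a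
  have hfin := aux_gron
    (u := fun t => φ (t, z + v + w, x) - φ (t, z + v, x) - φ (t, z + w, x) + φ (t, z, x))
    (u' := fun s => W (z + v + w, φ (s, z + v + w, x)) - W (z + v, φ (s, z + v, x))
      - W (z + w, φ (s, z + w, x)) + W (z, φ (s, z, x)))
    (e := M * (B * ‖v‖) * (B * ‖w‖)) hM (by positivity)
    ((((key _ x).1.sub (key _ x).1).sub (key _ x).1).add (key _ x).1)
    (fun s hs => ((((key _ x).2 s hs).sub ((key _ x).2 s hs)).sub ((key _ x).2 s hs)).add
      ((key _ x).2 s hs)) (by simp [hφ0]) ?_ t ht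
  · refine hfin.trans (le_of_eq ?_)
    ring
  intro s hs
  have hs' : s ∈ Icc (0:ℝ) 1 := ⟨hs.1, hs.2.le⟩
  have e1 := lip2 x (z + v) z s hs'
  have e2 := lip2 x (z + w) z s hs'
  rw [add_sub_cancel_left] at e1 e2
  set z0 : EuclideanSpace ℝ (Fin p) × EuclideanSpace ℝ (Fin d) := (z, φ (s, z, x)) with hz0
  set z1 : EuclideanSpace ℝ (Fin p) × EuclideanSpace ℝ (Fin d) :=
    (z + v, φ (s, z + v, x)) with hz1
  set z2 : EuclideanSpace ℝ (Fin p) × EuclideanSpace ℝ (Fin d) :=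
    (z + w, φ (s, z + w, x)) with hz2
  set z3 : EuclideanSpace ℝ (Fin p) × EuclideanSpace ℝ (Fin d) :=
    (z + v + w, φ (s, z + v + w, x)) with hz3
  have e3 := aux_four W hWC2 hM2 z0 (z1 - z0) (z2 - z0)
  rw [add_sub_cancel, add_sub_cancel] at e3
  have e4 := hLip z3 (z1 + (z2 - z0))
  have e5 : z3 - (z1 + (z2 - z0)) = (0, φ (s, z + v + w, x) - φ (s, z + v, x)
      - φ (s, z + w, x) + φ (s, z, x)) := by
    rw [hz0, hz1, hz2, hz3]
    ext1
    · simp only [Prod.fst_sub, Prod.fst_add]; abel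
    · simp only [Prod.snd_sub, Prod.snd_add]; abel
  rw [e5, Prod.norm_def] at e4
  simp only [norm_zero, norm_nonneg, sup_of_le_right] at e4
  have e6 : M * ‖z1 - z0‖ * ‖z2 - z0‖ ≤ M * (B * ‖v‖) * (B * ‖w‖) := by gcongr
  calc ‖W z3 - W z1 - W z2 + W z0‖
      = ‖(W z3 - W (z1 + (z2 - z0))) + (W (z1 + (z2 - z0)) - W z1 - W z2 + W z0)‖ := by
        congr 1; abel
    _ ≤ _ := norm_add_le _ _
    _ ≤ _ := add_le_add e4 (e3.trans e6)
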